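/- arXiv:2310.17859 — 4 statements merged into one kernel-verified Lean document; each statement's English description precedes it below -/
import Mathlib

section
/- Let t ≥ 2, n, k1, ..., kt be positive integers and d1, ..., dt be positive reals. Let 𝒜1 ⊆ C([n],k1), ..., 𝒜t ⊆ C([n],kt) be non-empty pairwise cross intersecting families with |𝒜i| ≥ C(n−1, ki−1) for some i ∈ [t]. Let mi = min{kj : j ∈ [t], j ≠ i}, and assume n ≥ ki + kj for all j ∈ [t] with j ≠ i. Then Σ_{j=1}^t dj·|𝒜j| ≤ max{ di·C(n,ki) − di·C(n−mi, ki) + Σ_{j∈[t], j≠i} dj·C(n−mi, kj−mi), Σ_{j=1}^t dj·C(n−1, kj−1) }. -/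
open Finset

attribute [local instance] Classical.propDecidable

noncomputable section

/-- The ground set `[n] = {1, …, n}`. -/
def ground (n : ℕ) : Finset ℕ := Finset.Icc 1 n

/-- `C([n], k)`: the family of all `k`-element subsets of `[n]`. -/
def ksubsets (n k : ℕ) : Finset (Finset ℕ) := Finset.powersetCard k (ground n)

/-- Two families are cross intersecting. -/
def CrossInt (A B : Finset (Finset ℕ)) : Prop :=
  ∀ a ∈ A, ∀ b ∈ B, (a ∩ b).Nonempty

/-- The lexicographic order `A ≺ B`:  `A ⊇ B` or `min (A ∖ B) < min (B ∖ A)`. -/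
def lex (A B : Finset ℕ) : Prop :=
  B ⊆ A ∨ (A \ B).min < (B \ A).min

/-- Strict lexicographic order `A ⪵ B`. -/
def lexLT (A B : Finset ℕ) : Prop := lex A B ∧ A ≠ B

/-- `L(R, k)` over `[n]`: all `k`-subsets of `[n]` that are `≺ R`. -/
def Lset (n : ℕ) (R : Finset ℕ) (k : ℕ) : Finset (Finset ℕ) :=
  (ksubsets n k).filter fun F => lex F R

/-- `L(r, k)`: the first `r` elements of `C([n], k)` in lexicographic order. -/
def Lnum (n r k : ℕ) : Finset (Finset ℕ) :=
  (ksubsets n k).filter fun F => ((ksubsets n k).filter fun G => lex G F).card ≤ r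

/-- A family is L-initial if it equals `L(R, k)` for some `k`-set `R` (an ID of the family). -/
def LInitial (n k : ℕ) (A : Finset (Finset ℕ)) : Prop :=
  ∃ R ∈ ksubsets n k, A = Lset n R k

/-- `F` and `H` strongly intersect at their last element; `H` is the partner of `F`
(and `F` is the partner of `H`). -/
def IsPartner (F H : Finset ℕ) : Prop :=
  ∃ q, F ∩ H = {q} ∧ F ∪ H = Finset.Icc 1 q

/-- `K` is the `k`-partner of `F` (inside `[n]`). -/
def IsKPartner (n k : ℕ) (F K : Finset ℕ) : Prop :=
  ∃ H, IsPartner F H ∧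
    ((k = H.card ∧ K = H) ∨
     (H.card < k ∧ K = H ∪ Finset.Icc (n - k + H.card + 1) n) ∨
     (k < H.card ∧ K ∈ ksubsets n k ∧ lex K H ∧
        ∀ K' ∈ ksubsets n k, lex K' H → lex K' K))

/-- `ℓ(F)`: the largest `x` with `{n - x + 1, …, n} ⊆ F` (and `0` if there is none). -/
def ell (n : ℕ) (F : Finset ℕ) : ℕ :=
  ((Finset.range (n + 1)).filter fun x => Finset.Icc (n - x + 1) n ⊆ F).sup id

/-- `F^t = {n - ℓ(F) + 1, …, n}` (which is `∅` when `ℓ(F) = 0`). -/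
def tailPart (n : ℕ) (F : Finset ℕ) : Finset ℕ := Finset.Icc (n - ell n F + 1) n

/-- Maximal cross intersecting families. -/
def MaximalCross (n f g : ℕ) (F G : Finset (Finset ℕ)) : Prop :=
  F ⊆ ksubsets n f ∧ G ⊆ ksubsets n g ∧ CrossInt F G ∧
    ∀ F' G' : Finset (Finset ℕ), F ⊆ F' → F' ⊆ ksubsets n f →
      G ⊆ G' → G' ⊆ ksubsets n g → CrossInt F' G' → F = F' ∧ G = G'

/-- The pair of sets `(F, G)` is maximal. -/
def PairMaximal (n : ℕ) (F G : Finset ℕ) : Prop :=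
  MaximalCross n F.card G.card (Lset n F F.card) (Lset n G G.card)

/-- Maximal pair families. -/
def MaximalPairFamilies (n : ℕ) (A1 A2 : Finset (Finset ℕ)) : Prop :=
  A1.card = A2.card ∧ ∀ a1 ∈ A1, ∃! a2, a2 ∈ A2 ∧ PairMaximal n a1 a2

/-- `H1` is the `|H1|`-parity of `H2` (intended for `|H1| ≤ |H2|`):
`H1 ∖ H1^t = H2 ∖ H2^t` and `ℓ(H2) - ℓ(H1) = |H2| - |H1|`. -/
def IsParity (n : ℕ) (H1 H2 : Finset ℕ) : Prop :=
  H1 \ tailPart n H1 = H2 \ tailPart n H2 ∧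
    ell n H2 + H1.card = ell n H1 + H2.card

/-- The family `H1` of `h1`-sets is the `h1`-parity of the family `H2` of `h2`-sets. -/
def FamParity (n h1 h2 : ℕ) (H1 H2 : Finset (Finset ℕ)) : Prop :=
  (∀ A ∈ H1, ∃ B ∈ ksubsets n h2, IsParity n A B ∧ B ∈ H2) ∧
  (∀ B ∈ H2, ∀ A ∈ ksubsets n h1, IsParity n A B → A ∈ H1)

/-- An `(n, k 0, …, k (t-1))`-cross intersecting system:  non-empty pairwise
cross intersecting families `F i ⊆ C([n], k i)`. -/
def IsCIS (n : ℕ) {t : ℕ} (k : Fin t → ℕ) (F : Fin t → Finset (Finset ℕ)) : Prop :=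
  (∀ i, F i ⊆ ksubsets n (k i)) ∧ (∀ i, (F i).Nonempty) ∧
    ∀ i j : Fin t, i < j → CrossInt (F i) (F j)

/-- An extremal cross intersecting system. -/
def Extremal (n : ℕ) {t : ℕ} (k : Fin t → ℕ) (F : Fin t → Finset (Finset ℕ)) : Prop :=
  IsCIS n k F ∧ ∀ G : Fin t → Finset (Finset ℕ), IsCIS n k G →
    ∑ i, (G i).card ≤ ∑ i, (F i).card

/-- Two systems of families are isomorphic via a permutation of the ground set `[n]`. -/
def IsoSystems (n : ℕ) {t : ℕ} (F G : Fin t → Finset (Finset ℕ)) : Prop :=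
  ∃ σ : Equiv.Perm ℕ, (∀ x ∈ ground n, σ x ∈ ground n) ∧
    ∀ i, F i = (G i).image fun s => s.image ⇑σ

/-- The family `ℛ₂`. -/
def R2fam (n k2 kt : ℕ) : Finset (Finset ℕ) :=
  (ksubsets n k2).filter fun R =>
    lex (insert 1 (Finset.Icc (n - k2 + 2) n)) R ∧
    lex R (insert kt (Finset.Icc (n - k2 + 2) n))

/-- The family `ℱ₂,₃`. -/
def F23 (n k2 k3 kt : ℕ) : Finset (Finset ℕ) :=
  (R2fam n k2 kt).filter fun A => ∃ B ∈ ksubsets n k3, PairMaximal n A B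

section KruskalKatona

variable {α : Type*}

/-- Iterated local LYM inequality for families of subsets of a fixed finite set. -/
lemma card_mul_choose_le_of_subsets_mem (P : Finset α) (T B : Finset (Finset α)) {b c : ℕ}
    (hbc : b ≤ c) (hT : ∀ t ∈ T, t ⊆ P ∧ t.card = c) (hB : ∀ s ∈ B, s ⊆ P ∧ s.card = b)
    (hTB : ∀ t ∈ T, ∀ s ⊆ t, s.card = b → s ∈ B) :
    T.card * P.card.choose b ≤ B.card * P.card.choose c := by
  have hcount : T.card * c.choose b ≤ B.card * (P.card - b).choose (c - b) := by
    refine card_mul_le_card_mul (fun t s => s ⊆ t) (fun t ht => ?_) (fun s hs => ?_)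
    · rw [← (hT t ht).2, ← card_powersetCard]
      refine card_le_card fun s hs => ?_
      rw [mem_powersetCard] at hs
      exact (mem_bipartiteAbove _).2 ⟨hTB t ht s hs.1 hs.2, hs.1⟩
    · obtain ⟨hsP, hsb⟩ := hB s hs
      rw [← hsb, ← card_sdiff_of_subset hsP, ← card_powersetCard]
      refine card_le_card_of_injOn (fun t => t \ s) (fun t ht => ?_) (fun t ht u hu htu => ?_)
      · obtain ⟨ht, hst⟩ := (mem_bipartiteBelow _).1 (mem_coe.1 ht)
        refine mem_powersetCard.2 ⟨sdiff_subset_sdiff (hT t ht).1 subset_rfl, ?_⟩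
        rw [card_sdiff_of_subset hst, (hT t ht).2]
      · have hst := ((mem_bipartiteBelow _).1 ht).2
        have hsu := ((mem_bipartiteBelow _).1 hu).2
        rw [← sdiff_union_of_subset hst, ← sdiff_union_of_subset hsu]
        exact congrArg (· ∪ s) htu
  refine Nat.le_of_mul_le_mul_right ?_ (Nat.choose_pos hbc)
  calc T.card * P.card.choose b * c.choose b = T.card * c.choose b * P.card.choose b := by ring
    _ ≤ B.card * (P.card - b).choose (c - b) * P.card.choose b := Nat.mul_le_mul_right _ hcount
    _ = B.card * (P.card.choose c * c.choose b) := by rw [Nat.choose_mul hbc]; ring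
    _ = B.card * P.card.choose c * c.choose b := by ring

lemma exists_isInitSeg_card [LinearOrder α] [Fintype α] (r N : ℕ)
    (hN : N ≤ (Fintype.card α).choose r) :
    ∃ 𝒞 : Finset (Finset α), Colex.IsInitSeg 𝒞 r ∧ 𝒞.card = N := by
  induction N with
  | zero => exact ⟨∅, Colex.isInitSeg_empty, rfl⟩
  | succ N ih =>
    obtain ⟨𝒞, h𝒞, hcard⟩ := ih (by lia)
    have hne : (powersetCard r (univ : Finset α) \ 𝒞).Nonempty := by
      rw [sdiff_nonempty]
      intro hsub
      have := card_le_card hsub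
      rw [card_powersetCard, card_univ] at this
      lia
    obtain ⟨s, hs, hmin⟩ := exists_min_image _ (fun s : Finset α => toColex s) hne
    rw [mem_sdiff, mem_powersetCard] at hs
    refine ⟨insert s 𝒞, ⟨?_, ?_⟩, by rw [card_insert_of_notMem hs.2, hcard]⟩
    · intro t ht
      rw [mem_coe, mem_insert] at ht
      rcases ht with rfl | ht
      · exact hs.1.2
      · exact h𝒞.1 ht
    · rintro u t hu ⟨htu, ht⟩
      rw [mem_insert] at hu ⊢
      rcases hu with rfl | hu
      · by_contra! h
        exact (hmin t (mem_sdiff.2 ⟨mem_powersetCard.2 ⟨subset_univ _, ht⟩, h.2⟩)).not_gt htu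
      · exact Or.inr (h𝒞.2 hu ⟨htu, ht⟩)

lemma isInitSeg_powersetCard_val_lt {n : ℕ} (r p : ℕ) :
    Colex.IsInitSeg (powersetCard r ({x | x.val < p} : Finset (Fin n))) r := by
  refine ⟨Set.sized_powersetCard _ _, ?_⟩
  rintro s t hs ⟨hts, ht⟩
  refine mem_powersetCard.2 ⟨fun x hx => ?_, ht⟩
  rw [mem_filter]
  refine ⟨mem_univ _, ?_⟩
  rcases lt_or_ge p n with hp | hp
  · exact Colex.forall_lt_mono (a := ⟨p, hp⟩) hts.le
      (fun b hb => (mem_filter.1 ((mem_powersetCard.1 hs).1 hb)).2) x hx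
  · exact x.2.trans_le hp

/-- Between consecutive binomial coefficients, the size of an iterated shadow is bounded below by
linear interpolation. -/
lemma card_iterated_shadow_ge_interpolation {n r a p : ℕ} (𝒜 ℬ : Finset (Finset (Fin n)))
    (h𝒜 : (𝒜 : Set (Finset (Fin n))).Sized r) (ha : 1 ≤ a) (har : a ≤ r) (hrp : r ≤ p) (hp : p < n)
    (hlo : p.choose r ≤ 𝒜.card) (hhi : 𝒜.card ≤ (p + 1).choose r)
    (hℬ : ∀ t ∈ 𝒜, ∀ s ⊆ t, s.card = a → s ∈ ℬ) :
    𝒜.card * p.choose (a - 1) + p.choose a * p.choose (r - 1) ≤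
      ℬ.card * p.choose (r - 1) + p.choose r * p.choose (a - 1) := by
  obtain ⟨𝒞, h𝒞, hcard⟩ := exists_isInitSeg_card (α := Fin n) r 𝒜.card (by
    rw [Fintype.card_fin]; exact hhi.trans (Nat.choose_le_choose _ hp))
  have hkk := iterated_kk (k := r - a) h𝒜 hcard.le h𝒞
  have hshadow : (shadow^[r - a] 𝒜).card ≤ ℬ.card := by
    refine card_le_card fun s hs => ?_
    obtain ⟨t, ht, hst, htc⟩ := mem_shadow_iterate_iff_exists_mem_card_add.1 hs
    have := h𝒜 ht
    exact hℬ t ht s hst (by lia)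
  set P : Finset (Fin n) := {x | x.val < p} with hP
  set Q : Finset (Fin n) := {x | x.val < p + 1} with hQ
  have hPc : P.card = p := by rw [hP, Fin.card_filter_val_lt]; lia
  have hQc : Q.card = p + 1 := by rw [hQ, Fin.card_filter_val_lt]; lia
  have hP𝒞 : powersetCard r P ⊆ 𝒞 := by
    rcases h𝒞.total (isInitSeg_powersetCard_val_lt r p) with h | h
    · exact (eq_of_subset_of_card_le h (by rw [card_powersetCard, hPc, hcard]; exact hlo)).ge
    · exact h
  have h𝒞Q : 𝒞 ⊆ powersetCard r Q := by
    rcases h𝒞.total (isInitSeg_powersetCard_val_lt r (p + 1)) with h | h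
    · exact h
    · exact (eq_of_subset_of_card_le h (by rw [card_powersetCard, hQc, hcard]; exact hhi)).ge
  set z : Fin n := ⟨p, hp⟩ with hz
  have hzP : z ∉ P := by simp [hP, hz]
  have hQP : ∀ x ∈ Q, x ≠ z → x ∈ P := by
    intro x hx hxz
    simp only [hQ, hP, mem_filter, mem_univ, true_and] at hx ⊢
    have : x.val ≠ p := fun h => hxz (Fin.ext h)
    lia
  set T : Finset (Finset (Fin n)) := {t ∈ powersetCard (r - 1) P | insert z t ∈ 𝒞} with hT
  have hTcard : 𝒜.card ≤ p.choose r + T.card := by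
    rw [← hcard, ← hPc, ← card_powersetCard]
    calc 𝒞.card ≤ (powersetCard r P ∪ T.image (insert z)).card := by
          refine card_le_card fun c hc => ?_
          obtain ⟨hcQ, hcr⟩ := mem_powersetCard.1 (h𝒞Q hc)
          rw [mem_union]
          by_cases hzc : z ∈ c
          · refine Or.inr (mem_image.2 ⟨c.erase z, ?_, insert_erase hzc⟩)
            refine mem_filter.2 ⟨mem_powersetCard.2 ⟨fun x hx => ?_, ?_⟩, ?_⟩
            · exact hQP x (hcQ (mem_of_mem_erase hx)) (ne_of_mem_erase hx)
            · rw [card_erase_of_mem hzc, hcr]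
            · rwa [insert_erase hzc]
          · refine Or.inl (mem_powersetCard.2 ⟨fun x hx => hQP x (hcQ hx) ?_, hcr⟩)
            rintro rfl
            exact hzc hx
      _ ≤ _ := (card_union_le _ _).trans (Nat.add_le_add_left card_image_le _)
  set B : Finset (Finset (Fin n)) := {s ∈ powersetCard (a - 1) P | ∃ t ∈ T, s ⊆ t} with hB
  have hBcard : p.choose a + B.card ≤ (shadow^[r - a] 𝒞).card := by
    have hinj : Set.InjOn (insert z) (B : Set (Finset (Fin n))) := by
      intro s hs t ht hst
      have hzs : z ∉ s := fun h => hzP ((mem_powersetCard.1 (mem_filter.1 hs).1).1 h)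
      have hzt : z ∉ t := fun h => hzP ((mem_powersetCard.1 (mem_filter.1 ht).1).1 h)
      rw [← erase_insert hzs, ← erase_insert hzt]
      exact congrArg (fun u => u.erase z) hst
    have hdisj : Disjoint (powersetCard a P) (B.image (insert z)) := by
      rw [disjoint_left]
      intro s hs hs'
      obtain ⟨t, -, rfl⟩ := mem_image.1 hs'
      exact hzP ((mem_powersetCard.1 hs).1 (mem_insert_self _ _))
    rw [← card_image_of_injOn hinj, ← hPc, ← card_powersetCard, ← card_union_of_disjoint hdisj]
    refine card_le_card fun s hs => ?_
    rw [mem_shadow_iterate_iff_exists_mem_card_add]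
    rcases mem_union.1 hs with hs | hs
    · obtain ⟨hsP, hsc⟩ := mem_powersetCard.1 hs
      obtain ⟨t, hst, htP, htc⟩ :=
        exists_subsuperset_card_eq (n := r) hsP (by lia) (by lia)
      exact ⟨t, hP𝒞 (mem_powersetCard.2 ⟨htP, htc⟩), hst, by lia⟩
    · obtain ⟨s, hsB, rfl⟩ := mem_image.1 hs
      obtain ⟨hs', t, ht, hst⟩ := mem_filter.1 hsB
      obtain ⟨hsP, hsc⟩ := mem_powersetCard.1 hs'
      obtain ⟨ht, htz⟩ := mem_filter.1 ht
      obtain ⟨htP, htc⟩ := mem_powersetCard.1 ht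
      refine ⟨_, htz, insert_subset_insert _ hst, ?_⟩
      rw [card_insert_of_notMem fun h => hzP (htP h), card_insert_of_notMem fun h => hzP (hsP h)]
      lia
  have hlym : T.card * p.choose (a - 1) ≤ B.card * p.choose (r - 1) := by
    rw [← hPc]
    refine card_mul_choose_le_of_subsets_mem P T B (by lia)
      (fun t ht => mem_powersetCard.1 (mem_filter.1 ht).1)
      (fun t ht => mem_powersetCard.1 (mem_filter.1 ht).1) (fun t ht s hst hs => ?_)
    refine mem_filter.2 ⟨mem_powersetCard.2 ⟨?_, hs⟩, t, ht, hst⟩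
    exact hst.trans (mem_powersetCard.1 (mem_filter.1 ht).1).1
  have h1 : p.choose a + B.card ≤ ℬ.card := hBcard.trans (hkk.trans hshadow)
  nlinarith [Nat.mul_le_mul_right (p.choose (a - 1)) hTcard,
    Nat.mul_le_mul_right (p.choose (r - 1)) h1]

lemma choose_mul_choose_le_of_le {j k b c : ℕ} (hbc : b ≤ c) (hjk : j ≤ k) :
    k.choose b * j.choose c ≤ j.choose b * k.choose c := by
  refine Nat.le_of_mul_le_mul_right ?_ (Nat.choose_pos hbc)
  calc k.choose b * j.choose c * c.choose b
      = k.choose b * j.choose b * (j - b).choose (c - b) := by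
        rw [mul_assoc, Nat.choose_mul hbc, mul_assoc]
    _ ≤ k.choose b * j.choose b * (k - b).choose (c - b) :=
        Nat.mul_le_mul_left _ (Nat.choose_le_choose _ (by lia))
    _ = j.choose b * k.choose c * c.choose b := by
        rw [mul_assoc (j.choose b), Nat.choose_mul hbc]; ring

lemma exists_choose_le_le_choose_succ {p q r z : ℕ} (hpq : p ≤ q) (hlo : p.choose r ≤ z)
    (hhi : z ≤ q.choose r) :
    ∃ k, p ≤ k ∧ k ≤ q ∧ k.choose r ≤ z ∧ z ≤ (k + 1).choose r := by
  induction q, hpq using Nat.le_induction with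
  | base => exact ⟨p, le_rfl, le_rfl, hlo, hhi.trans (Nat.choose_le_choose _ (by lia))⟩
  | succ q hpq ih =>
    rcases le_total z (q.choose r) with h | h
    · obtain ⟨k, h1, h2, h3, h4⟩ := ih h
      exact ⟨k, h1, by lia, h3, h4⟩
    · exact ⟨q, hpq, by lia, h, hhi⟩

/-- The piecewise linear interpolation of `p.choose r ↦ p.choose a` is concave: each of its
supporting lines lies above all the interpolated points. -/
lemma choose_supporting_line {r a j k : ℕ} (ha : 1 ≤ a) (har : a ≤ r) :
    (k.choose (r - 1) : ℝ) * j.choose a - k.choose (a - 1) * j.choose r ≤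
      k.choose (r - 1) * k.choose a - k.choose (a - 1) * k.choose r := by
  obtain ⟨b, rfl⟩ : ∃ b, a = b + 1 := ⟨a - 1, by lia⟩
  obtain ⟨c, rfl⟩ : ∃ c, r = c + 1 := ⟨r - 1, by lia⟩
  have hbc : b ≤ c := by lia
  simp only [Nat.add_sub_cancel]
  rcases le_total j k with hjk | hkj
  · induction hjk using Nat.decreasingInduction with
    | self => rfl
    | of_succ j hjk ih =>
      refine le_trans ?_ ih
      have h : (k.choose b * j.choose c : ℝ) ≤ j.choose b * k.choose c := by
        exact_mod_cast choose_mul_choose_le_of_le hbc hjk.le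
      rw [Nat.choose_succ_succ j b, Nat.choose_succ_succ j c]
      push_cast
      linarith
  · induction j, hkj using Nat.le_induction with
    | base => rfl
    | succ j hkj ih =>
      refine le_trans ?_ ih
      have h : (j.choose b * k.choose c : ℝ) ≤ k.choose b * j.choose c := by
        exact_mod_cast choose_mul_choose_le_of_le hbc hkj
      rw [Nat.choose_succ_succ j b, Nat.choose_succ_succ j c]
      push_cast
      linarith

/-- The size of an iterated shadow is bounded below by linear interpolation between any two
binomial coefficients. -/
lemma card_le_chord_of_shadow {n r a p q : ℕ} (𝒜 ℬ : Finset (Finset (Fin n)))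
    (h𝒜 : (𝒜 : Set (Finset (Fin n))).Sized r) (ha : 1 ≤ a) (har : a ≤ r) (hrp : r ≤ p)
    (hpq : p ≤ q) (hq : q < n) (hℬ : ∀ t ∈ 𝒜, ∀ s ⊆ t, s.card = a → s ∈ ℬ) (y : ℝ)
    (hℬy : ℬ.card ≤ y) (hlo : p.choose a ≤ y) (hhi : y ≤ q.choose a) (hz : 𝒜.card ≤ q.choose r) :
    (𝒜.card : ℝ) * (q.choose a - p.choose a) ≤
      (y - p.choose a) * q.choose r + (q.choose a - y) * p.choose r := by
  suffices h : (q.choose a - y) * (𝒜.card - p.choose r) ≤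
      (y - p.choose a) * (q.choose r - 𝒜.card) by linarith
  have hz' : (𝒜.card : ℝ) ≤ q.choose r := by exact_mod_cast hz
  rcases le_total 𝒜.card (p.choose r) with hzp | hzp
  · have hzp' : (𝒜.card : ℝ) ≤ p.choose r := by exact_mod_cast hzp
    exact (mul_nonpos_of_nonneg_of_nonpos (by linarith) (by linarith)).trans
      (mul_nonneg (by linarith) (by linarith))
  · have hzp' : (p.choose r : ℝ) ≤ 𝒜.card := by exact_mod_cast hzp
    obtain ⟨k, hpk, hkq, hk, hk'⟩ := exists_choose_le_le_choose_succ hpq hzp hz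
    have hkk := card_iterated_shadow_ge_interpolation 𝒜 ℬ h𝒜 ha har (hrp.trans hpk)
      (hkq.trans_lt hq) hk hk' hℬ
    rify at hkk
    have hp' := choose_supporting_line (j := p) (k := k) ha har
    have hq' := choose_supporting_line (j := q) (k := k) ha har
    have hU : (0 : ℝ) < k.choose (r - 1) := by exact_mod_cast Nat.choose_pos (by lia)
    have hy := mul_le_mul_of_nonneg_left hℬy hU.le
    have h1 : (k.choose (a - 1) : ℝ) * (𝒜.card - p.choose r) ≤
        k.choose (r - 1) * (y - p.choose a) := by linarith
    have h2 : (k.choose (r - 1) : ℝ) * (q.choose a - y) ≤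
        k.choose (a - 1) * (q.choose r - 𝒜.card) := by linarith
    refine le_of_mul_le_mul_left ?_ hU
    have h3 := mul_le_mul_of_nonneg_right h1 (sub_nonneg.2 hz')
    have h4 := mul_le_mul_of_nonneg_right h2 (sub_nonneg.2 hzp')
    linarith

/-- A family whose shadow is no larger than that of a full binomial family is itself no larger. -/
lemma card_le_choose_of_shadow {n r a q : ℕ} (𝒜 ℬ : Finset (Finset (Fin n)))
    (h𝒜 : (𝒜 : Set (Finset (Fin n))).Sized r) (ha : 1 ≤ a) (har : a ≤ r) (hrq : r ≤ q)
    (hq : q + 1 = n) (hℬ : ∀ t ∈ 𝒜, ∀ s ⊆ t, s.card = a → s ∈ ℬ)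
    (hhi : ℬ.card ≤ q.choose a) : 𝒜.card ≤ q.choose r := by
  by_contra! h
  have hcard : 𝒜.card ≤ (q + 1).choose r := by
    simpa [hq] using h𝒜.card_le
  have hkk := card_iterated_shadow_ge_interpolation 𝒜 ℬ h𝒜 ha har hrq (by lia) h.le hcard hℬ
  have hD : 0 < q.choose (a - 1) := Nat.choose_pos (by lia)
  nlinarith [Nat.mul_le_mul_right (q.choose (r - 1)) hhi, Nat.mul_lt_mul_of_pos_right h hD]

end KruskalKatona

section CrossIntersecting

variable {n a b : ℕ} {F G : Finset (Finset ℕ)}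

lemma CrossInt.symm (h : CrossInt F G) : CrossInt G F := fun g hg f hf => by
  rw [inter_comm]
  exact h f hf g hg

lemma mem_ksubsets {s : Finset ℕ} : s ∈ ksubsets n a ↔ s ⊆ Icc 1 n ∧ s.card = a :=
  mem_powersetCard

lemma card_ksubsets (n a : ℕ) : (ksubsets n a).card = n.choose a := by
  simp [ksubsets, ground]

/-- Transport of a subset of `{0, …, n - 1}` to `[n]`. -/
def toGround {n : ℕ} (s : Finset (Fin n)) : Finset ℕ :=
  s.map (Fin.valEmbedding.trans (addRightEmbedding 1))

lemma mem_toGround {s : Finset (Fin n)} {x : ℕ} : x ∈ toGround s ↔ ∃ y ∈ s, y.val + 1 = x := by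
  simp [toGround]

lemma toGround_injective : Function.Injective (toGround (n := n)) := map_injective _

lemma toGround_mem_ksubsets {s : Finset (Fin n)} (hs : s.card = a) :
    toGround s ∈ ksubsets n a := by
  rw [mem_ksubsets]
  refine ⟨fun x hx => ?_, by rw [toGround, card_map, hs]⟩
  obtain ⟨y, -, rfl⟩ := mem_toGround.1 hx
  have := y.2
  rw [mem_Icc]
  lia

/-- The complement of `g ⊆ [n]`, transported to `{0, …, n - 1}`. -/
def finCompl (n : ℕ) (g : Finset ℕ) : Finset (Fin n) := {x | x.val + 1 ∉ g}

lemma toGround_finCompl {g : Finset ℕ} : toGround (finCompl n g) = Icc 1 n \ g := by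
  ext x
  simp only [mem_toGround, finCompl, mem_filter, mem_univ, true_and, mem_sdiff, mem_Icc]
  constructor
  · rintro ⟨y, hy, rfl⟩
    have := y.2
    exact ⟨by lia, hy⟩
  · rintro ⟨hx, hxg⟩
    refine ⟨⟨x - 1, by lia⟩, ?_, ?_⟩
    · simpa [Nat.sub_add_cancel hx.1] using hxg
    · simpa using Nat.sub_add_cancel hx.1

lemma finCompl_injOn : Set.InjOn (finCompl n) (ksubsets n b : Set (Finset ℕ)) := by
  intro g hg h hh hgh
  have := congrArg toGround hgh
  rw [toGround_finCompl, toGround_finCompl] at this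
  rw [← Finset.sdiff_sdiff_eq_self (mem_ksubsets.1 hg).1, this,
    Finset.sdiff_sdiff_eq_self (mem_ksubsets.1 hh).1]

lemma card_finCompl {g : Finset ℕ} (hg : g ∈ ksubsets n b) : (finCompl n g).card = n - b := by
  rw [mem_ksubsets] at hg
  have h : (toGround (finCompl n g)).card = n - b := by
    rw [toGround_finCompl, card_sdiff_of_subset hg.1, hg.2, Nat.card_Icc, Nat.add_sub_cancel]
  rwa [toGround, card_map] at h

lemma disjoint_toGround_of_subset_finCompl {s : Finset (Fin n)} {g : Finset ℕ}
    (hs : s ⊆ finCompl n g) : Disjoint (toGround s) g := by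
  have h : toGround s ⊆ Icc 1 n \ g := by
    rw [← toGround_finCompl]
    exact map_subset_map.2 hs
  exact disjoint_of_subset_left h sdiff_disjoint

/-- The size of one of two cross intersecting families is bounded by linear interpolation in the
size of the other. -/
lemma CrossInt.card_le_chord {m : ℕ} (hFG : CrossInt F G) (hF : F ⊆ ksubsets n a)
    (hG : G ⊆ ksubsets n b) (ha : 1 ≤ a) (hm : 1 ≤ m) (hmb : m ≤ b) (hab : a + b ≤ n) (y : ℝ)
    (hy : y = n.choose a - F.card) (hlo : (n - m).choose a ≤ y) (hhi : y ≤ (n - 1).choose a) :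
    G.card ≤ (n - 1).choose (b - 1) ∧
    (G.card : ℝ) * ((n - 1).choose a - (n - m).choose a) ≤
      (y - (n - m).choose a) * (n - 1).choose (b - 1) +
        ((n - 1).choose a - y) * (n - m).choose (b - m) := by
  set 𝒜 : Finset (Finset (Fin n)) := G.image (finCompl n) with h𝒜
  set ℬ : Finset (Finset (Fin n)) := {s | s.card = a ∧ toGround s ∉ F} with hℬ
  have hcard : 𝒜.card = G.card := card_image_of_injOn (finCompl_injOn.mono (coe_subset.2 hG))
  have hsized : (𝒜 : Set (Finset (Fin n))).Sized (n - b) := by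
    intro s hs
    obtain ⟨g, hg, rfl⟩ := mem_image.1 (mem_coe.1 hs)
    exact card_finCompl (hG hg)
  have hshadow : ∀ t ∈ 𝒜, ∀ s ⊆ t, s.card = a → s ∈ ℬ := by
    intro t ht s hst hs
    obtain ⟨g, hg, rfl⟩ := mem_image.1 ht
    refine mem_filter.2 ⟨mem_univ _, hs, fun hsF => ?_⟩
    exact (hFG _ hsF g hg).ne_empty
      (disjoint_iff_inter_eq_empty.1 (disjoint_toGround_of_subset_finCompl hst))
  have hℬy : (ℬ.card : ℝ) ≤ y := by
    have h : ℬ.card ≤ (ksubsets n a \ F).card := by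
      refine card_le_card_of_injOn toGround (fun s hs => ?_) toGround_injective.injOn
      obtain ⟨-, hs, hsF⟩ := mem_filter.1 (mem_coe.1 hs)
      exact mem_sdiff.2 ⟨toGround_mem_ksubsets hs, hsF⟩
    rw [card_sdiff_of_subset hF, card_ksubsets] at h
    have hle := card_le_card hF
    rw [card_ksubsets] at hle
    rw [hy, ← Nat.cast_sub hle]
    exact_mod_cast h
  have h1 : (n - 1).choose (b - 1) = (n - 1).choose (n - b) :=
    Nat.choose_symm_of_eq_add (by lia)
  have h2 : (n - m).choose (b - m) = (n - m).choose (n - b) :=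
    Nat.choose_symm_of_eq_add (by lia)
  have hz : 𝒜.card ≤ (n - 1).choose (n - b) :=
    card_le_choose_of_shadow 𝒜 ℬ hsized ha (by lia) (by lia) (by lia) hshadow
      (by exact_mod_cast hℬy.trans hhi)
  rw [h1, h2, ← hcard]
  exact ⟨hz, card_le_chord_of_shadow 𝒜 ℬ hsized ha (by lia) (by lia) (by lia) (by lia) hshadow y
    hℬy hlo hhi hz⟩

lemma CrossInt.card_add_choose_le (hFG : CrossInt F G) (hF : F ⊆ ksubsets n a)
    (hG : G ⊆ ksubsets n b) (hne : G.Nonempty) :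
    F.card + (n - b).choose a ≤ n.choose a := by
  obtain ⟨g, hg⟩ := hne
  obtain ⟨hgn, hgb⟩ := mem_ksubsets.1 (hG hg)
  have hc : (Icc 1 n \ g).card = n - b := by
    rw [card_sdiff_of_subset hgn, hgb, Nat.card_Icc, Nat.add_sub_cancel]
  rw [← hc, ← card_powersetCard, ← card_ksubsets n a, ← card_union_of_disjoint]
  · exact card_le_card (union_subset hF (powersetCard_mono sdiff_subset))
  · rw [disjoint_left]
    intro s hsF hs
    exact (hFG s hsF g hg).ne_empty (disjoint_iff_inter_eq_empty.1
      (disjoint_of_subset_left (mem_powersetCard.1 hs).1 sdiff_disjoint))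

end CrossIntersecting

/-- weighted Huang–Peng bound: the weighted sum of sizes of non-empty
pairwise cross intersecting families, one of which is at least star-sized, is bounded
by the maximum of the two natural weighted benchmarks. -/
theorem weighted_cross_bound (n t : ℕ) (k : Fin t → ℕ) (d : Fin t → ℝ)
    (A : Fin t → Finset (Finset ℕ))
    (ht : 2 ≤ t) (hn : 0 < n) (hkpos : ∀ i, 0 < k i) (hdpos : ∀ i, 0 < d i)
    (hsys : IsCIS n k A)
    (i : Fin t) (hAi : Nat.choose (n - 1) (k i - 1) ≤ (A i).card)
    (mi : ℕ) (hmi_le : ∀ j, j ≠ i → mi ≤ k j) (hmi_mem : ∃ j, j ≠ i ∧ k j = mi)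
    (hni : ∀ j, j ≠ i → k i + k j ≤ n) :
    ∑ j, d j * (A j).card ≤
      max (d i * Nat.choose n (k i) - d i * Nat.choose (n - mi) (k i) +
            ∑ j ∈ Finset.univ.filter (fun j => j ≠ i),
              d j * Nat.choose (n - mi) (k j - mi))
          (∑ j, d j * Nat.choose (n - 1) (k j - 1)) := by
  obtain ⟨hsub, hne, hcross⟩ := hsys
  have hcr : ∀ j, j ≠ i → CrossInt (A i) (A j) := by
    intro j hj
    rcases lt_or_gt_of_ne hj with h | h
    · exact (hcross j i h).symm
    · exact hcross i j h
  obtain ⟨j₀, hj₀, rfl⟩ := hmi_mem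
  set m := k j₀
  have hi := hkpos i
  have hmpos : 1 ≤ m := hkpos j₀
  have hpascal : (n.choose (k i) : ℝ) = (n - 1).choose (k i - 1) + (n - 1).choose (k i) := by
    exact_mod_cast Nat.choose_eq_choose_pred_add hn hi
  obtain ⟨y, hy⟩ : ∃ y : ℝ, y = n.choose (k i) - (A i).card := ⟨_, rfl⟩
  have hlo : ((n - m).choose (k i) : ℝ) ≤ y := by
    have h := (hcr j₀ hj₀).card_add_choose_le (hsub i) (hsub j₀) (hne j₀)
    rify at h
    linarith
  have hhi : y ≤ (n - 1).choose (k i) := by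
    rify at hAi
    linarith
  have hchord : ∀ j, j ≠ i → _ := fun j hj =>
    (hcr j hj).card_le_chord (hsub i) (hsub j) hi hmpos (hmi_le j hj) (hni j hj) y hy hlo hhi
  have hsplit : ∀ f : Fin t → ℝ, ∑ j, f j = f i + ∑ j ∈ univ.filter (fun j => j ≠ i), f j := by
    intro f
    rw [filter_ne', add_sum_erase _ _ (mem_univ i)]
  rw [hsplit, hsplit fun j => d j * ((n - 1).choose (k j - 1) : ℕ)]
  set v₁ : ℝ := (((n - m).choose (k i) : ℕ) : ℝ)
  set v₀ : ℝ := (((n - 1).choose (k i) : ℕ) : ℝ)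
  have hv : v₁ ≤ v₀ := hlo.trans hhi
  rcases hv.eq_or_lt with hv | hv
  · refine le_trans (add_le_add (mul_le_mul_of_nonneg_left ?_ (hdpos i).le)
      (sum_le_sum fun j hj => mul_le_mul_of_nonneg_left ?_ (hdpos j).le)) (le_max_right _ _)
    · linarith
    · exact_mod_cast (hchord j (mem_filter.1 hj).2).1
  · refine le_of_mul_le_mul_left ?_ (sub_pos.2 hv)
    have hsum : (v₀ - v₁) * ∑ j ∈ univ.filter (fun j => j ≠ i), d j * ((A j).card : ℝ) ≤
        (y - v₁) * ∑ j ∈ univ.filter (fun j => j ≠ i), d j * ((n - 1).choose (k j - 1) : ℝ) +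
        (v₀ - y) * ∑ j ∈ univ.filter (fun j => j ≠ i), d j * ((n - m).choose (k j - m) : ℝ) := by
      rw [mul_sum, mul_sum, mul_sum, ← sum_add_distrib]
      refine sum_le_sum fun j hj => ?_
      have h := mul_le_mul_of_nonneg_left (hchord j (mem_filter.1 hj).2).2 (hdpos j).le
      linarith
    have hAy : ((A i).card : ℝ) = n.choose (k i) - y := by linarith
    have hstar : ((n - 1).choose (k i - 1) : ℝ) = n.choose (k i) - v₀ := by linarith
    have h1 := mul_le_mul_of_nonneg_left (le_max_left
      (d i * (n.choose (k i) : ℝ) - d i * v₁ +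
        ∑ j ∈ univ.filter (fun j => j ≠ i), d j * ((n - m).choose (k j - m) : ℝ))
      (d i * ((n - 1).choose (k i - 1) : ℝ) +
        ∑ j ∈ univ.filter (fun j => j ≠ i), d j * ((n - 1).choose (k j - 1) : ℝ)))
      (sub_nonneg.2 hhi)
    have h2 := mul_le_mul_of_nonneg_left (le_max_right
      (d i * (n.choose (k i) : ℝ) - d i * v₁ +
        ∑ j ∈ univ.filter (fun j => j ≠ i), d j * ((n - m).choose (k j - m) : ℝ))
      (d i * ((n - 1).choose (k i - 1) : ℝ) +
        ∑ j ∈ univ.filter (fun j => j ≠ i), d j * ((n - 1).choose (k j - 1) : ℝ)))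
      (sub_nonneg.2 hlo)
    rw [hAy]
    rw [hstar] at h1 h2 ⊢
    linarith
end
end

section
/- If 𝒜 ⊆ C([n],k) and ℬ ⊆ C([n],l) are cross intersecting families, then L(|𝒜|, k) and L(|ℬ|, l) are cross intersecting as well. -/
open Finset

attribute [local instance] Classical.propDecidable

noncomputable section

/-- A shadow-form consequence of Kruskal–Katona: if no member of `ℬ` lies inside a member of `𝒜`,
the same holds for a colex-initial segment `𝒞` no larger than `𝒜` and a colex-final segment `𝒟`
no larger than `ℬ`. -/
theorem not_subset_of_colex_segments {n m l : ℕ} (hlm : l ≤ m)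
    {𝒜 ℬ 𝒞 𝒟 : Finset (Finset (Fin n))}
    (h𝒜 : (𝒜 : Set (Finset (Fin n))).Sized m) (hℬ : (ℬ : Set (Finset (Fin n))).Sized l)
    (h𝒜ℬ : ∀ s ∈ 𝒜, ∀ t ∈ ℬ, ¬ t ⊆ s)
    (h𝒞𝒜 : #𝒞 ≤ #𝒜) (h𝒞 : Colex.IsInitSeg 𝒞 m) (h𝒟ℬ : #𝒟 ≤ #ℬ)
    (h𝒟l : (𝒟 : Set (Finset (Fin n))).Sized l)
    (h𝒟 : ∀ s ∈ 𝒟, ∀ t : Finset (Fin n), #t = l → toColex s ≤ toColex t → t ∈ 𝒟) :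
    ∀ s ∈ 𝒞, ∀ t ∈ 𝒟, ¬ t ⊆ s := by
  intro s hs t ht hts
  have hml : m - (m - l) = l := by omega
  have shadow_initSeg : ∀ i, Colex.IsInitSeg ((shadow (α := Fin n))^[i] 𝒞) (m - i) := by
    intro i
    induction i with
    | zero => simpa using h𝒞
    | succ i ih =>
      rw [Function.iterate_succ_apply', Nat.sub_add_eq]
      convert ih.shadow
  have hS := shadow_initSeg (m - l)
  rw [hml] at hS
  have hcard := iterated_kk (k := m - l) h𝒜 h𝒞𝒜 h𝒞
  set 𝒮 := (shadow (α := Fin n))^[m - l] 𝒞 with h𝒮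
  set 𝒯 := (shadow (α := Fin n))^[m - l] 𝒜 with h𝒯
  have hcard : #𝒮 ≤ #𝒯 := by convert hcard
  have hT : (𝒯 : Set (Finset (Fin n))).Sized l := by
    have := h𝒜.shadow_iterate (k := m - l)
    rwa [hml] at this
  have ht𝒮 : t ∈ 𝒮 := by
    rw [h𝒮, mem_shadow_iterate_iff_exists_mem_card_add]
    exact ⟨s, hs, hts, by rw [h𝒞.1 hs, h𝒟l ht]; omega⟩
  have hdisj : Disjoint 𝒯 ℬ := by
    refine disjoint_left.2 fun u hu hu' ↦ ?_
    rw [h𝒯, mem_shadow_iterate_iff_exists_mem_card_add] at hu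
    obtain ⟨v, hv, huv, -⟩ := hu
    exact h𝒜ℬ v hv u hu' huv
  have hupper : #𝒯 + #ℬ ≤ #(powersetCard l (univ : Finset (Fin n))) := by
    rw [← card_union_of_disjoint hdisj]
    refine card_le_card fun u hu ↦ mem_powersetCard.2 ⟨subset_univ _, ?_⟩
    exact (mem_union.1 hu).elim (fun h ↦ hT h) fun h ↦ hℬ h
  have hlower : #(powersetCard l (univ : Finset (Fin n))) ≤ #(𝒮 ∪ 𝒟) := by
    refine card_le_card fun u hu ↦ mem_union.2 ?_
    have hul := (mem_powersetCard.1 hu).2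
    rcases lt_or_ge (toColex u) (toColex t) with hut | htu
    · exact Or.inl (hS.2 ht𝒮 ⟨hut, hul⟩)
    · exact Or.inr (h𝒟 t ht u hul htu)
  have hinter : 0 < #(𝒮 ∩ 𝒟) := card_pos.2 ⟨t, mem_inter.2 ⟨ht𝒮, ht⟩⟩
  have := card_union_add_card_inter 𝒮 𝒟
  omega

theorem lex_iff_forall_exists_le {F G : Finset ℕ} :
    lex F G ↔ ∀ a ∈ G, a ∉ F → ∃ b ∈ F, b ∉ G ∧ b ≤ a := by
  constructor
  · rintro (h | h) a haG haF
    · exact absurd (h haG) haF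
    · have hlt := h.trans_le (min_le (mem_sdiff.2 ⟨haG, haF⟩))
      obtain ⟨b, hb⟩ := WithTop.ne_top_iff_exists.1 hlt.ne_top
      have hbm := mem_sdiff.1 (mem_of_min hb.symm)
      rw [← hb] at hlt
      exact ⟨b, hbm.1, hbm.2, (WithTop.coe_lt_coe.1 hlt).le⟩
  · intro h
    by_cases hGF : G ⊆ F
    · exact Or.inl hGF
    · obtain ⟨a, ha⟩ := min_of_nonempty (sdiff_nonempty.2 hGF)
      obtain ⟨haG, haF⟩ := mem_sdiff.1 (mem_of_min ha)
      obtain ⟨b, hbF, hbG, hba⟩ := h a haG haF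
      refine Or.inr ((min_le (mem_sdiff.2 ⟨hbF, hbG⟩)).trans_lt ?_)
      rw [ha]
      exact WithTop.coe_lt_coe.2 (hba.lt_of_ne (ne_of_mem_of_not_mem hbF haF))

/-- The trace of `F` on `[n]`, read in decreasing order as a subset of `Fin n`. -/
def revTrace (n : ℕ) (F : Finset ℕ) : Finset (Fin n) := univ.filter fun i ↦ n - i.val ∈ F

theorem mem_revTrace {n : ℕ} {F : Finset ℕ} {i : Fin n} : i ∈ revTrace n F ↔ n - i.val ∈ F := by
  simp [revTrace]

theorem image_revTrace {n : ℕ} {F : Finset ℕ} (hF : F ⊆ ground n) :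
    (revTrace n F).image (fun i ↦ n - i.val) = F := by
  ext a
  simp only [mem_image, mem_revTrace]
  constructor
  · rintro ⟨i, hi, rfl⟩
    exact hi
  · intro ha
    have := mem_Icc.1 (hF ha)
    have hsub : n - (n - a) = a := by omega
    exact ⟨⟨n - a, by omega⟩, by simpa [hsub] using ha, hsub⟩

theorem sub_val_injective (n : ℕ) : Function.Injective fun i : Fin n ↦ n - i.val := by
  intro i j hij
  have := i.isLt
  have := j.isLt
  ext
  dsimp only at hij
  omega

theorem card_revTrace {n : ℕ} {F : Finset ℕ} (hF : F ⊆ ground n) : #(revTrace n F) = #F := by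
  rw [← card_image_of_injective _ (sub_val_injective n), image_revTrace hF]

theorem revTrace_image {n : ℕ} (s : Finset (Fin n)) :
    revTrace n (s.image fun i ↦ n - i.val) = s := by
  ext i
  rw [mem_revTrace]
  exact (sub_val_injective n).mem_finset_image

theorem exists_revTrace_eq {n : ℕ} (s : Finset (Fin n)) :
    ∃ F ∈ ksubsets n #s, revTrace n F = s := by
  refine ⟨s.image fun i ↦ n - i.val, mem_powersetCard.2 ⟨?_, ?_⟩, by convert revTrace_image s⟩
  · intro a ha
    obtain ⟨i, -, rfl⟩ := mem_image.1 ha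
    have := i.isLt
    exact mem_Icc.2 (by omega)
  · exact card_image_of_injective _ (sub_val_injective n)

theorem revTrace_injOn (n k : ℕ) : Set.InjOn (revTrace n) (ksubsets n k : Set (Finset ℕ)) := by
  intro F hF G hG h
  rw [← image_revTrace (mem_powersetCard.1 hF).1, h, image_revTrace (mem_powersetCard.1 hG).1]

theorem revTrace_subset_compl_iff {n : ℕ} {F G : Finset ℕ} (hG : G ⊆ ground n) :
    revTrace n G ⊆ (revTrace n F)ᶜ ↔ ¬ (F ∩ G).Nonempty := by
  constructor
  · rintro h ⟨a, ha⟩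
    obtain ⟨haF, haG⟩ := mem_inter.1 ha
    rw [← image_revTrace hG] at haG
    obtain ⟨i, hi, rfl⟩ := mem_image.1 haG
    exact mem_compl.1 (h hi) (mem_revTrace.2 haF)
  · intro h i hi
    exact mem_compl.2 fun hi' ↦ h ⟨_, mem_inter.2 ⟨mem_revTrace.1 hi', mem_revTrace.1 hi⟩⟩

theorem lex_iff_toColex_revTrace_le {n : ℕ} {F G : Finset ℕ} (hF : F ⊆ ground n)
    (hG : G ⊆ ground n) : lex F G ↔ toColex (revTrace n G) ≤ toColex (revTrace n F) := by
  rw [lex_iff_forall_exists_le, Colex.toColex_le_toColex]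
  simp only [mem_revTrace]
  constructor
  · intro h i hiG hiF
    obtain ⟨b, hbF, hbG, hb⟩ := h _ hiG hiF
    rw [← image_revTrace hF] at hbF
    obtain ⟨j, hj, rfl⟩ := mem_image.1 hbF
    have := i.isLt
    have := j.isLt
    exact ⟨j, mem_revTrace.1 hj, hbG, Fin.le_def.2 (by omega)⟩
  · intro h a haG haF
    rw [← image_revTrace hG] at haG
    obtain ⟨i, hi, rfl⟩ := mem_image.1 haG
    obtain ⟨j, hjF, hjG, hij⟩ := h (mem_revTrace.1 hi) haF
    have := Fin.le_def.1 hij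
    exact ⟨_, hjF, hjG, by omega⟩

theorem toColex_compl_le_toColex_compl {n : ℕ} {s t : Finset (Fin n)} :
    toColex sᶜ ≤ toColex tᶜ ↔ toColex t ≤ toColex s := by
  simp only [Colex.toColex_le_toColex, mem_compl, not_not]
  exact ⟨fun h a hat has ↦ (h has hat).imp fun b hb ↦ ⟨hb.2.1, hb.1, hb.2.2⟩,
    fun h a has hat ↦ (h hat has).imp fun b hb ↦ ⟨hb.2.1, hb.1, hb.2.2⟩⟩

theorem lex_trans {n : ℕ} {F G H : Finset ℕ} (hF : F ⊆ ground n) (hG : G ⊆ ground n)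
    (hH : H ⊆ ground n) (hFG : lex F G) (hGH : lex G H) : lex F H := by
  rw [lex_iff_toColex_revTrace_le hF hG] at hFG
  rw [lex_iff_toColex_revTrace_le hG hH] at hGH
  exact (lex_iff_toColex_revTrace_le hF hH).2 (hGH.trans hFG)

theorem Lnum_subset (n r k : ℕ) : Lnum n r k ⊆ ksubsets n k := filter_subset _ _

theorem mem_Lnum_of_lex {n r k : ℕ} {F G : Finset ℕ} (hF : F ∈ Lnum n r k)
    (hG : G ∈ ksubsets n k) (hGF : lex G F) : G ∈ Lnum n r k := by
  obtain ⟨hFk, hFr⟩ := mem_filter.1 hF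
  refine mem_filter.2 ⟨hG, (card_le_card fun H hH ↦ ?_).trans hFr⟩
  obtain ⟨hHk, hHG⟩ := mem_filter.1 hH
  exact mem_filter.2 ⟨hHk, lex_trans (mem_powersetCard.1 hHk).1 (mem_powersetCard.1 hG).1
    (mem_powersetCard.1 hFk).1 hHG hGF⟩

theorem card_Lnum_le (n r k : ℕ) : #(Lnum n r k) ≤ r := by
  obtain h | h := (Lnum n r k).eq_empty_or_nonempty
  · simp [h]
  obtain ⟨F, hF, hmin⟩ := exists_min_image _ (fun F ↦ toColex (revTrace n F)) h
  obtain ⟨hFk, hFr⟩ := mem_filter.1 hF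
  refine (card_le_card fun G hG ↦ mem_filter.2 ⟨Lnum_subset n r k hG, ?_⟩).trans hFr
  exact (lex_iff_toColex_revTrace_le (mem_powersetCard.1 (Lnum_subset n r k hG)).1
    (mem_powersetCard.1 hFk).1).2 (hmin G hG)

theorem sized_image_revTrace {n k : ℕ} {A : Finset (Finset ℕ)} (hA : A ⊆ ksubsets n k) :
    (A.image (revTrace n) : Set (Finset (Fin n))).Sized k := by
  intro s hs
  obtain ⟨F, hF, rfl⟩ := mem_image.1 (mem_coe.1 hs)
  obtain ⟨hFn, hFk⟩ := mem_powersetCard.1 (hA hF)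
  rw [card_revTrace hFn, hFk]

theorem sized_image_compl_revTrace {n k : ℕ} {A : Finset (Finset ℕ)} (hA : A ⊆ ksubsets n k) :
    (A.image (fun F ↦ (revTrace n F)ᶜ) : Set (Finset (Fin n))).Sized (n - k) := by
  intro s hs
  obtain ⟨F, hF, rfl⟩ := mem_image.1 (mem_coe.1 hs)
  obtain ⟨hFn, hFk⟩ := mem_powersetCard.1 (hA hF)
  rw [card_compl, Fintype.card_fin, card_revTrace hFn, hFk]

theorem card_image_revTrace {n k : ℕ} {A : Finset (Finset ℕ)} (hA : A ⊆ ksubsets n k) :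
    #(A.image (revTrace n)) = #A :=
  card_image_of_injOn ((revTrace_injOn n k).mono (coe_subset.2 hA))

theorem card_image_compl_revTrace {n k : ℕ} {A : Finset (Finset ℕ)} (hA : A ⊆ ksubsets n k) :
    #(A.image fun F ↦ (revTrace n F)ᶜ) = #A :=
  card_image_of_injOn fun _ hF _ hG h ↦ revTrace_injOn n k (hA hF) (hA hG) (compl_injective h)

theorem image_revTrace_Lnum_upward_closed {n r k : ℕ} {s t : Finset (Fin n)}
    (hs : s ∈ (Lnum n r k).image (revTrace n)) (ht : #t = k) (hst : toColex s ≤ toColex t) :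
    t ∈ (Lnum n r k).image (revTrace n) := by
  obtain ⟨F, hF, rfl⟩ := mem_image.1 hs
  obtain ⟨G, hG, rfl⟩ := exists_revTrace_eq t
  rw [ht] at hG
  refine mem_image_of_mem _ (mem_Lnum_of_lex hF hG ?_)
  exact (lex_iff_toColex_revTrace_le (mem_powersetCard.1 hG).1
    (mem_powersetCard.1 (Lnum_subset n r k hF)).1).2 hst

theorem isInitSeg_image_compl_revTrace_Lnum {n r k : ℕ} (hk : k ≤ n) :
    Colex.IsInitSeg ((Lnum n r k).image fun F ↦ (revTrace n F)ᶜ) (n - k) := by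
  refine ⟨sized_image_compl_revTrace (Lnum_subset n r k), fun s t hs ⟨hts, ht⟩ ↦ ?_⟩
  obtain ⟨F, hF, rfl⟩ := mem_image.1 hs
  have htc : #tᶜ = k := by rw [card_compl, Fintype.card_fin, ht]; omega
  have hle := hts.le
  rw [← compl_compl t, toColex_compl_le_toColex_compl] at hle
  obtain ⟨G, hG, hGt⟩ := mem_image.1
    (image_revTrace_Lnum_upward_closed (mem_image_of_mem _ hF) htc hle)
  exact mem_image.2 ⟨G, hG, by rw [hGt, compl_compl]⟩

/-- Kruskal–Katona reformulation: if `𝒜 ⊆ C([n],k)` and `ℬ ⊆ C([n],l)` are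
cross intersecting, then so are `L(|𝒜|, k)` and `L(|ℬ|, l)`. -/
theorem kruskalKatona_cross (n k l : ℕ) (A B : Finset (Finset ℕ))
    (hA : A ⊆ ksubsets n k) (hB : B ⊆ ksubsets n l)
    (h : CrossInt A B) :
    CrossInt (Lnum n A.card k) (Lnum n B.card l) := by
  by_contra hcross
  simp only [CrossInt, not_forall] at hcross
  obtain ⟨F, hF, G, hG, hFG⟩ := hcross
  obtain ⟨hFn, hFk⟩ := mem_powersetCard.1 (Lnum_subset _ _ _ hF)
  obtain ⟨hGn, hGl⟩ := mem_powersetCard.1 (Lnum_subset _ _ _ hG)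
  have hkl : k + l ≤ n := by
    rw [← hFk, ← hGl, ← card_union_of_disjoint
      (disjoint_iff_inter_eq_empty.2 (not_nonempty_iff_eq_empty.1 hFG))]
    simpa [ground] using card_le_card (union_subset hFn hGn)
  refine not_subset_of_colex_segments (m := n - k) (l := l) (by omega)
    (sized_image_compl_revTrace hA) (sized_image_revTrace hB) ?_ ?_
    (isInitSeg_image_compl_revTrace_Lnum (r := A.card) (by omega)) ?_
    (sized_image_revTrace (Lnum_subset n B.card l))
    (fun s hs t ht hst ↦ image_revTrace_Lnum_upward_closed hs ht hst)
    _ (mem_image_of_mem _ hF) _ (mem_image_of_mem _ hG)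
    ((revTrace_subset_compl_iff hGn).2 hFG)
  · intro s hs t ht hts
    obtain ⟨a, ha, rfl⟩ := mem_image.1 hs
    obtain ⟨b, hb, rfl⟩ := mem_image.1 ht
    exact (revTrace_subset_compl_iff (mem_powersetCard.1 (hB hb)).1).1 hts (h a ha b hb)
  · rw [card_image_compl_revTrace hA, card_image_compl_revTrace (Lnum_subset _ _ _)]
    exact card_Lnum_le _ _ _
  · rw [card_image_revTrace hB, card_image_revTrace (Lnum_subset _ _ _)]
    exact card_Lnum_le _ _ _
end
end

section
/- Let a, b, n be positive integers with a + b ≤ n, let P ⊆ [n] be non-empty with |P| ≤ a, and let Q be the partner of P. Then L(Q,b) is the maximum L-initial b-uniform family cross intersecting with L(P,a): L(P,a) and L(Q,b) are cross intersecting, and every L-initial family ℬ ⊆ C([n],b) that is cross intersecting with L(P,a) satisfies ℬ ⊆ L(Q,b). -/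
open Finset

attribute [local instance] Classical.propDecidable

noncomputable section

theorem min_lt_min_iff_exists {S T : Finset ℕ} :
    S.min < T.min ↔ ∃ x ∈ S, ∀ y ∈ T, x < y := by
  constructor
  · intro h
    obtain ⟨x, hx⟩ := WithTop.ne_top_iff_exists.1 h.ne_top
    refine ⟨x, mem_of_min hx.symm, fun y hy => ?_⟩
    rw [← hx] at h
    exact WithTop.coe_lt_coe.1 (h.trans_le (min_le hy))
  · rintro ⟨x, hx, h⟩
    refine (min_le hx).trans_lt ?_
    rcases T.eq_empty_or_nonempty with rfl | hT
    · simp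
    · obtain ⟨y, hy⟩ := min_of_nonempty hT
      rw [hy]
      exact WithTop.coe_lt_coe.2 (h y (mem_of_min hy))

theorem lex_iff {A B : Finset ℕ} :
    lex A B ↔ B ⊆ A ∨ ∃ x ∈ A \ B, ∀ y ∈ B \ A, x < y := by
  rw [lex, min_lt_min_iff_exists]

theorem exists_lt_of_not_lex {A B : Finset ℕ} (h : ¬ lex A B) :
    ∃ x ∈ B \ A, ∀ y ∈ A \ B, x < y := by
  rw [lex, not_or, not_lt] at h
  obtain ⟨hsub, hmin⟩ := h
  refine min_lt_min_iff_exists.1 (hmin.lt_of_ne fun heq => ?_)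
  obtain ⟨x, hx⟩ := min_of_nonempty (sdiff_nonempty.2 hsub)
  exact (mem_sdiff.1 (mem_of_min hx)).2 (mem_sdiff.1 (mem_of_min (heq ▸ hx))).1

/-- Sets preceding two partners intersect. -/
theorem IsPartner.inter_nonempty_of_lex {P Q F G : Finset ℕ} (hPQ : IsPartner P Q)
    (hF : lex F P) (hG : lex G Q) (hF0 : 0 ∉ F) (hG0 : 0 ∉ G) : (F ∩ G).Nonempty := by
  obtain ⟨q, hinter, hunion⟩ := hPQ
  have hq : q ∈ P ∧ q ∈ Q := mem_inter.1 (hinter ▸ mem_singleton_self q)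
  have hcover (x : ℕ) : x ∈ P ∨ x ∈ Q ↔ 1 ≤ x ∧ x ≤ q := by
    rw [← mem_union, hunion, mem_Icc]
  by_contra hne
  have hdisj : ∀ x ∈ F, x ∉ G := fun x hx hx' => hne ⟨x, mem_inter.2 ⟨hx, hx'⟩⟩
  rw [lex_iff] at hF hG
  simp only [mem_sdiff, subset_iff] at hF hG
  have hpos : (∀ x ∈ F, 1 ≤ x) ∧ ∀ x ∈ G, 1 ≤ x :=
    ⟨fun x hx => Nat.one_le_iff_ne_zero.2 fun h => hF0 (h ▸ hx),
      fun x hx => Nat.one_le_iff_ne_zero.2 fun h => hG0 (h ▸ hx)⟩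
  rcases hF with hF | ⟨x, ⟨hxF, hxP⟩, hx⟩ <;> rcases hG with hG | ⟨y, ⟨hyG, hyQ⟩, hy⟩
  · exact hdisj q (hF hq.1) (hG hq.2)
  · grind
  · grind
  · grind

/-- If `G` does not precede the partner `Q` of `P`, some `a`-set preceding `P` avoids `G`. -/
theorem IsPartner.exists_disjoint_of_not_lex {a b n : ℕ} {P Q G : Finset ℕ}
    (hPQ : IsPartner P Q) (hab : a + b ≤ n) (hP : P ⊆ ground n) (hPa : P.card ≤ a)
    (hG : G ∈ ksubsets n b) (hGQ : ¬ lex G Q) : ∃ F ∈ Lset n P a, Disjoint F G := by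
  obtain ⟨q, hinter, hunion⟩ := hPQ
  have hq : q ∈ P ∧ q ∈ Q := mem_inter.1 (hinter ▸ mem_singleton_self q)
  have huniq {x : ℕ} (hxP : x ∈ P) (hxQ : x ∈ Q) : x = q :=
    mem_singleton.1 (hinter ▸ mem_inter.2 ⟨hxP, hxQ⟩)
  obtain ⟨hGn, hGb⟩ := mem_powersetCard.1 hG
  obtain ⟨x, hx, hmin⟩ := exists_lt_of_not_lex hGQ
  obtain ⟨hxQ, hxG⟩ := mem_sdiff.1 hx
  have hxq : 1 ≤ x ∧ x ≤ q := mem_Icc.1 (hunion ▸ mem_union_right P hxQ)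
  have hqn : 1 ≤ q ∧ q ≤ n := mem_Icc.1 (hP hq.1)
  have hST : insert x (P.filter (· < x)) ⊆ ground n \ G := by
    intro z hz
    rcases mem_insert.1 hz with rfl | hz
    · exact mem_sdiff.2 ⟨mem_Icc.2 ⟨hxq.1, hxq.2.trans hqn.2⟩, hxG⟩
    · obtain ⟨hzP, hzx⟩ := mem_filter.1 hz
      refine mem_sdiff.2 ⟨hP hzP, fun hzG => ?_⟩
      have hzQ : z ∈ Q := by
        by_contra h
        exact hzx.not_gt (hmin z (mem_sdiff.2 ⟨hzG, h⟩))
      have := huniq hzP hzQ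
      omega
  have hSa : (insert x (P.filter (· < x))).card ≤ a := by
    refine le_trans ?_ hPa
    refine (card_insert_le _ _).trans (Nat.succ_le_of_lt (card_lt_card ?_))
    exact filter_ssubset.2 ⟨q, hq.1, hxq.2.not_gt⟩
  have haT : a ≤ (ground n \ G).card := by
    rw [card_sdiff_of_subset hGn, hGb, ground, Nat.card_Icc]
    omega
  obtain ⟨F, hSF, hFT, hFa⟩ := exists_subsuperset_card_eq hST hSa haT
  refine ⟨F, mem_filter.2 ⟨mem_powersetCard.2 ⟨hFT.trans sdiff_subset, hFa⟩, ?_⟩,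
    disjoint_sdiff_self_left.mono_left hFT⟩
  have hxF : x ∈ F := hSF (mem_insert_self _ _)
  have hbelow {z : ℕ} (hzP : z ∈ P) (hzx : z < x) : z ∈ F :=
    hSF (mem_insert_of_mem (mem_filter.2 ⟨hzP, hzx⟩))
  have hPx : ∀ z ∈ P, z ≤ q := fun z hz =>
    (mem_Icc.1 (hunion ▸ mem_union_left Q hz : z ∈ Icc 1 q)).2
  rw [lex_iff]
  by_cases hxP : x ∈ P
  · obtain rfl := huniq hxP hxQ
    refine Or.inl fun z hz => ?_
    rcases (hPx z hz).lt_or_eq with h | rfl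
    exacts [hbelow hz h, hxF]
  · refine Or.inr ⟨x, mem_sdiff.2 ⟨hxF, hxP⟩, fun z hz => ?_⟩
    obtain ⟨hzP, hzF⟩ := mem_sdiff.1 hz
    by_contra h
    rcases (not_lt.1 h).lt_or_eq with h | rfl
    exacts [hzF (hbelow hzP h), hxP hzP]

/-- for `a + b ≤ n`, a non-empty `P ⊆ [n]` with `|P| ≤ a` and `Q` the partner
of `P`, the family `L(Q,b)` is the maximum L-initial `b`-uniform family cross
intersecting with `L(P,a)`. -/
theorem partner_gives_max_Linitial (a b n : ℕ) (ha : 0 < a) (hb : 0 < b) (hn : 0 < n)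
    (hab : a + b ≤ n) (P Q : Finset ℕ) (hP : P ⊆ ground n) (hPne : P.Nonempty)
    (hPa : P.card ≤ a) (hQ : IsPartner P Q) :
    CrossInt (Lset n P a) (Lset n Q b) ∧
      ∀ B : Finset (Finset ℕ), B ⊆ ksubsets n b → LInitial n b B →
        CrossInt (Lset n P a) B → B ⊆ Lset n Q b := by
  constructor
  · intro F hF G hG
    obtain ⟨hF, hFP⟩ := mem_filter.1 hF
    obtain ⟨hG, hGQ⟩ := mem_filter.1 hG
    have hzero {S : Finset ℕ} {k : ℕ} (hS : S ∈ ksubsets n k) : 0 ∉ S := fun h =>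
      absurd (mem_Icc.1 ((mem_powersetCard.1 hS).1 h)).1 (by simp)
    exact hQ.inter_nonempty_of_lex hFP hGQ (hzero hF) (hzero hG)
  · intro B hB _ hcross G hG
    refine mem_filter.2 ⟨hB hG, ?_⟩
    by_contra hGQ
    obtain ⟨F, hF, hFG⟩ := hQ.exists_disjoint_of_not_lex hab hP hPa (hB hG) hGQ
    exact (hcross F hF G hG).ne_empty (disjoint_iff_inter_eq_empty.1 hFG)
end
end

section
/- Let a, b, n be positive integers with n ≥ a + b, let A ⊆ [n] with |A| = a, and let B be the b-partner of A. Then L(B,b) is the maximum L-initial b-uniform family cross intersecting with L(A,a): L(A,a) and L(B,b) are cross intersecting, and every L-initial family ℬ ⊆ C([n],b) that is cross intersecting with L(A,a) satisfies ℬ ⊆ L(B,b). -/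
open Finset

attribute [local instance] Classical.propDecidable

noncomputable section

theorem lex_iff_exists {A B : Finset ℕ} :
    lex A B ↔ B ⊆ A ∨ ∃ i ∈ A, i ∉ B ∧ ∀ j ∈ B, j ∉ A → i < j := by
  refine or_congr Iff.rfl ⟨fun h => ?_, ?_⟩
  · have hne : (A \ B).Nonempty := by
      rw [Finset.nonempty_iff_ne_empty]
      intro h0
      simp [h0] at h
    obtain ⟨i, hi⟩ := Finset.min_of_nonempty hne
    have hmem := Finset.mem_sdiff.1 (Finset.mem_of_min hi)
    refine ⟨i, hmem.1, hmem.2, fun j hj hjA => ?_⟩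
    have hle : (B \ A).min ≤ j := Finset.min_le (Finset.mem_sdiff.2 ⟨hj, hjA⟩)
    rw [hi] at h
    exact WithTop.coe_lt_coe.1 (h.trans_le hle)
  · rintro ⟨i, hiA, hiB, h⟩
    refine (Finset.min_le (Finset.mem_sdiff.2 ⟨hiA, hiB⟩)).trans_lt ?_
    rcases (B \ A).eq_empty_or_nonempty with h0 | hne
    · rw [h0, Finset.min_empty]
      exact WithTop.coe_lt_top i
    · obtain ⟨j, hj⟩ := Finset.min_of_nonempty hne
      have hmem := Finset.mem_sdiff.1 (Finset.mem_of_min hj)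
      rw [hj]
      exact WithTop.coe_lt_coe.2 (h j hmem.1 hmem.2)

theorem lex_refl (A : Finset ℕ) : lex A A := Or.inl subset_rfl

theorem lex_trans_s6 {A B C : Finset ℕ} (hAB : lex A B) (hBC : lex B C) : lex A C := by
  rw [lex_iff_exists] at *
  rcases hAB with hAB | ⟨i, hiA, hiB, hi⟩ <;> rcases hBC with hBC | ⟨j, hjB, hjC, hj⟩
  · exact Or.inl (hBC.trans hAB)
  · exact Or.inr ⟨j, hAB hjB, hjC, fun x hx hxA => hj x hx fun h => hxA (hAB h)⟩
  · exact Or.inr ⟨i, hiA, fun h => hiB (hBC h), fun x hx hxA => hi x (hBC hx) hxA⟩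
  · right
    rcases lt_trichotomy i j with hij | rfl | hij
    · exact ⟨i, hiA, fun h => (hj i h hiB).not_gt hij, fun x hx hxA => by
        by_cases hxB : x ∈ B
        · exact hi x hxB hxA
        · exact hij.trans (hj x hx hxB)⟩
    · exact absurd hjB hiB
    · refine ⟨j, by_contra fun h => (hi j hjB h).not_gt hij, hjC, fun x hx hxA => ?_⟩
      by_cases hxB : x ∈ B
      · exact hij.trans (hi x hxB hxA)
      · exact hj x hx hxB

theorem exists_of_not_lex {A B : Finset ℕ} (h : ¬ lex A B) :
    ∃ i ∈ B, i ∉ A ∧ ∀ j ∈ A, j ∉ B → i < j := by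
  rw [lex_iff_exists, not_or] at h
  obtain ⟨hsub, hex⟩ := h
  have hne : (B \ A).Nonempty := Finset.sdiff_nonempty.2 hsub
  have hmem := Finset.mem_sdiff.1 (Finset.min'_mem _ hne)
  refine ⟨_, hmem.1, hmem.2, fun j hjA hjB => ?_⟩
  by_contra hlt
  refine hex ⟨j, hjA, hjB, fun x hxB hxA => ?_⟩
  have hle := Finset.min'_le _ x (Finset.mem_sdiff.2 ⟨hxB, hxA⟩)
  have hxj : j ≠ x := fun h => hjB (h ▸ hxB)
  omega

theorem mem_union_Icc_iff {F H : Finset ℕ} {q : ℕ} (h : F ∪ H = Finset.Icc 1 q) (x : ℕ) :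
    x ∈ F ∨ x ∈ H ↔ 1 ≤ x ∧ x ≤ q := by
  rw [← Finset.mem_union, h, Finset.mem_Icc]

theorem mem_inter_singleton_iff {F H : Finset ℕ} {q : ℕ} (h : F ∩ H = {q}) (x : ℕ) :
    x ∈ F ∧ x ∈ H ↔ x = q := by
  rw [← Finset.mem_inter, h, Finset.mem_singleton]

/-- Sets of positive integers preceding the two members of a partner pair intersect,
regardless of their sizes. -/
theorem IsPartner.inter_nonempty {A H X Y : Finset ℕ} (hAH : IsPartner A H)
    (hX0 : 0 ∉ X) (hY0 : 0 ∉ Y) (hX : lex X A) (hY : lex Y H) : (X ∩ Y).Nonempty := by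
  obtain ⟨q, hint, hun⟩ := hAH
  have hu := mem_union_Icc_iff hun
  have hq := mem_inter_singleton_iff hint
  obtain ⟨hqA, hqH⟩ := (hq q).2 rfl
  have hX1 : ∀ x ∈ X, 1 ≤ x := fun x hx => Nat.one_le_iff_ne_zero.2 fun h => hX0 (h ▸ hx)
  have hY1 : ∀ x ∈ Y, 1 ≤ x := fun x hx => Nat.one_le_iff_ne_zero.2 fun h => hY0 (h ▸ hx)
  rw [lex_iff_exists] at hX hY
  by_contra hne
  have hdisj : ∀ x ∈ X, x ∉ Y := fun x hx hy => hne ⟨x, Finset.mem_inter.2 ⟨hx, hy⟩⟩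
  by_cases hXA : A ⊆ X <;> by_cases hYH : H ⊆ Y
  · exact hdisj q (hXA hqA) (hYH hqH)
  all_goals grind

/-- A `b`-set not preceding the partner of `A` is disjoint from some set preceding `A`. -/
theorem IsPartner.exists_disjoint {a b n : ℕ} {A H R : Finset ℕ} (hAH : IsPartner A H)
    (hab : a + b ≤ n) (hA : A ∈ ksubsets n a) (hR : R ∈ ksubsets n b) (hRH : ¬ lex R H) :
    ∃ X ∈ Lset n A a, Disjoint X R := by
  obtain ⟨q, hint, hun⟩ := hAH
  have hu := mem_union_Icc_iff hun
  have hq := mem_inter_singleton_iff hint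
  obtain ⟨hqA, hqH⟩ := (hq q).2 rfl
  obtain ⟨i, hiH, hiR, hi⟩ := exists_of_not_lex hRH
  obtain ⟨hAn, hAa⟩ := Finset.mem_powersetCard.1 hA
  obtain ⟨hRn, hRb⟩ := Finset.mem_powersetCard.1 hR
  have hiq : i ≤ q := ((hu i).1 (Or.inr hiH)).2
  have hqn : q ≤ n := (Finset.mem_Icc.1 (hAn hqA)).2
  set base := insert i (A.filter (· < i)) with hbase
  have hsub : base ⊆ ground n \ R := by
    intro x hx
    rw [Finset.mem_sdiff]
    rcases Finset.mem_insert.1 hx with rfl | hx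
    · exact ⟨Finset.mem_Icc.2 ⟨((hu x).1 (Or.inr hiH)).1, hiq.trans hqn⟩, hiR⟩
    · obtain ⟨hxA, hxi⟩ := Finset.mem_filter.1 hx
      refine ⟨hAn hxA, fun hxR => ?_⟩
      by_cases hxH : x ∈ H
      · have := (hq x).1 ⟨hxA, hxH⟩
        omega
      · exact (hi x hxR hxH).not_gt hxi
  have hcard : base.card ≤ a := by
    have hle : (A.filter (· < i)).card ≤ (A.erase q).card := by
      refine Finset.card_le_card fun x hx => ?_
      obtain ⟨hxA, hxi⟩ := Finset.mem_filter.1 hx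
      exact Finset.mem_erase.2 ⟨by omega, hxA⟩
    have h1 := Finset.card_erase_add_one hqA
    have h2 := Finset.card_insert_le i (A.filter (· < i))
    rw [← hbase] at h2
    omega
  have hcompl : a ≤ (ground n \ R).card := by
    rw [Finset.card_sdiff_of_subset hRn, hRb, ground, Nat.card_Icc]
    omega
  obtain ⟨X, hbX, hXn, hXa⟩ := Finset.exists_subsuperset_card_eq hsub hcard hcompl
  refine ⟨X, Finset.mem_filter.2 ⟨Finset.mem_powersetCard.2
    ⟨hXn.trans Finset.sdiff_subset, hXa⟩, lex_iff_exists.2 ?_⟩,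
    Finset.disjoint_left.2 fun x hx => (Finset.mem_sdiff.1 (hXn hx)).2⟩
  have hiX : i ∈ X := hbX (Finset.mem_insert_self _ _)
  have hlt : ∀ x ∈ A, x < i → x ∈ X := fun x hx hxi =>
    hbX (Finset.mem_insert_of_mem (Finset.mem_filter.2 ⟨hx, hxi⟩))
  by_cases hiA : i ∈ A
  · left
    intro x hx
    have hiq' := (hq i).1 ⟨hiA, hiH⟩
    rcases (((hu x).1 (Or.inl hx)).2).lt_or_eq with hxq | rfl
    · exact hlt x hx (hiq' ▸ hxq)
    · exact hiq' ▸ hiX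
  · exact Or.inr ⟨i, hiX, hiA, fun x hx hxX => by grind⟩

/-- Appending the last elements of `[n]` to `H` gives the last `b`-set preceding `H`. -/
theorem lex_union_Icc {b n q : ℕ} {H Y : Finset ℕ} (hHb : H.card ≤ b) (hbn : b ≤ n)
    (hHq : ∀ x ∈ H, x ≤ q) (hq : q ≤ n - b + H.card) (hY : Y ∈ ksubsets n b)
    (hYH : lex Y H) : lex Y (H ∪ Finset.Icc (n - b + H.card + 1) n) := by
  obtain ⟨hYn, hYb⟩ := Finset.mem_powersetCard.1 hY
  by_contra hnot
  obtain ⟨i, hiK, hiY, hi⟩ := exists_of_not_lex hnot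
  rw [Finset.mem_union, Finset.mem_Icc] at hiK
  by_cases hsub : H ⊆ Y
  · have hYK : Y ⊆ H ∪ Finset.Icc (n - b + H.card + 1) n := by
      intro j hj
      by_contra hjK
      have hij := hi j hj hjK
      have hjn := (Finset.mem_Icc.1 (hYn hj)).2
      rcases hiK with hiH | hiT
      · exact hiY (hsub hiH)
      · exact hjK (Finset.mem_union_right _ (Finset.mem_Icc.2 ⟨by omega, hjn⟩))
    have hle := Finset.card_union_le H (Finset.Icc (n - b + H.card + 1) n)
    rw [Nat.card_Icc] at hle
    have heq := Finset.eq_of_subset_of_card_le hYK (by omega)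
    exact hnot (heq ▸ lex_refl Y)
  · obtain ⟨j, hjH, hjY⟩ := Finset.not_subset.1 hsub
    rcases lex_iff_exists.1 hYH with h | ⟨k, hkY, hkH, hk⟩
    · exact hsub h
    · have hkj := hk j hjH hjY
      have hjq := hHq j hjH
      have hik := hi k hkY (by
        rw [Finset.mem_union, Finset.mem_Icc, not_or]
        exact ⟨hkH, by omega⟩)
      rcases hiK with hiH | hiT
      · exact (hk i hiH hiY).not_gt hik
      · omega

theorem zero_notMem_of_mem_ksubsets {n k : ℕ} {F : Finset ℕ} (hF : F ∈ ksubsets n k) :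
    0 ∉ F := fun h => by
  simpa [ground] using (Finset.mem_powersetCard.1 hF).1 h

/-- A `b`-set precedes the `b`-partner of `A` iff it precedes the partner of `A`. -/
theorem IsKPartner.exists_partner_lex_iff {a b n : ℕ} {A B : Finset ℕ}
    (hB : IsKPartner n b A B) (hab : a + b ≤ n) (hA : A.card = a) :
    ∃ H, IsPartner A H ∧ ∀ Y ∈ ksubsets n b, (lex Y B ↔ lex Y H) := by
  obtain ⟨H, hAH, ⟨-, rfl⟩ | ⟨hlt, rfl⟩ | ⟨-, -, hBH, hlast⟩⟩ := hB
  · exact ⟨B, hAH, fun _ _ => Iff.rfl⟩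
  · refine ⟨H, hAH, fun Y hY => ⟨fun h => lex_trans_s6 h (Or.inl Finset.subset_union_left), ?_⟩⟩
    obtain ⟨q, hint, hun⟩ := hAH
    have hu := mem_union_Icc_iff hun
    have hcard := Finset.card_union_add_card_inter A H
    rw [hint, hun, Nat.card_Icc, Finset.card_singleton] at hcard
    exact lex_union_Icc hlt.le (by omega) (fun x hx => ((hu x).1 (Or.inr hx)).2) (by omega) hY
  · exact ⟨H, hAH, fun Y hY => ⟨fun h => lex_trans_s6 h hBH, hlast Y hY⟩⟩

/-- for `n ≥ a + b`, `A ⊆ [n]` with `|A| = a` and `B` the `b`-partner of `A`,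
the family `L(B,b)` is the maximum L-initial `b`-uniform family cross intersecting
with `L(A,a)`. -/
theorem bpartner_gives_max_Linitial (a b n : ℕ) (ha : 0 < a) (hb : 0 < b) (hn : 0 < n)
    (hab : a + b ≤ n) (A B : Finset ℕ) (hA : A ⊆ ground n) (hAa : A.card = a)
    (hB : IsKPartner n b A B) :
    CrossInt (Lset n A a) (Lset n B b) ∧
      ∀ C : Finset (Finset ℕ), C ⊆ ksubsets n b → LInitial n b C →
        CrossInt (Lset n A a) C → C ⊆ Lset n B b := by
  obtain ⟨H, hAH, hiff⟩ := hB.exists_partner_lex_iff hab hAa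
  refine ⟨fun X hX Y hY => ?_, ?_⟩
  · obtain ⟨hXk, hXA⟩ := Finset.mem_filter.1 hX
    obtain ⟨hYk, hYB⟩ := Finset.mem_filter.1 hY
    exact hAH.inter_nonempty (zero_notMem_of_mem_ksubsets hXk)
      (zero_notMem_of_mem_ksubsets hYk) hXA ((hiff Y hYk).1 hYB)
  · rintro C hC ⟨R, hR, rfl⟩ hcross Y hY
    refine Finset.mem_filter.2 ⟨hC hY, lex_trans_s6 (Finset.mem_filter.1 hY).2 ?_⟩
    by_contra hRB
    obtain ⟨X, hX, hdisj⟩ := hAH.exists_disjoint hab (Finset.mem_powersetCard.2 ⟨hA, hAa⟩) hR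
      fun h => hRB ((hiff R hR).2 h)
    exact Finset.not_disjoint_iff_nonempty_inter.2
      (hcross X hX R (Finset.mem_filter.2 ⟨hR, lex_refl R⟩)) hdisj
end
end
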